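/- arXiv:1305.5184 — 4 statements merged into one kernel-verified Lean document; each statement's English description precedes it below -/
import Mathlib

section
/- The number of producers of a causet y equals the number of equivalence classes of maximal chains in y, where two maximal chains C₁, C₂ of y with maximal elements a₁, a₂ respectively are equivalent if the posets y ∖ {a₁} and y ∖ {a₂} are order-isomorphic. Explicitly, the map sending the equivalence class of a maximal chain C with maximal element a to the isomorphism class of y ∖ {a} is a bijection from equivalence classes of maximal chains of y onto the set of isomorphism classes of causets x with x → y. -/
open scoped Classical ComplexOrder

noncomputable section

abbrev PO (n : ℕ) := PartialOrder (Fin n)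

def poIso {n : ℕ} (p q : PO n) : Prop :=
  Nonempty (@OrderIso (Fin n) (Fin n) p.toLE q.toLE)

instance causetSetoid (n : ℕ) : Setoid (PO n) where
  r := poIso
  iseqv := by
    refine ⟨fun p => ⟨@OrderIso.refl (Fin n) p.toLE⟩, ?_, ?_⟩
    · rintro p q ⟨e⟩
      exact ⟨@OrderIso.symm (Fin n) (Fin n) p.toLE q.toLE e⟩
    · rintro p q r ⟨e⟩ ⟨f⟩
      exact ⟨@OrderIso.trans (Fin n) (Fin n) (Fin n) p.toLE q.toLE r.toLE e f⟩

def Causet (n : ℕ) : Type := Quotient (causetSetoid n)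

instance (n : ℕ) : Finite (PO n) :=
  Finite.of_injective (fun p : PO n => @LE.le (Fin n) p.toLE)
    (fun _p _q h => PartialOrder.ext fun a b => iff_of_eq (congrFun (congrFun h a) b))

instance (n : ℕ) : Finite (Causet n) := Quotient.finite _
instance (n : ℕ) : Fintype (Causet n) := Fintype.ofFinite _

/-- `p` produces `q`: `q` is obtained from `p` by adjoining a single maximal element. -/
def producesPO {n : ℕ} (p : PO n) (q : PO (n + 1)) : Prop :=
  ∃ a : Fin (n + 1), (∀ b : Fin (n + 1), q.le a b → b = a) ∧
    Nonempty (@OrderIso (Fin n) {b : Fin (n + 1) // b ≠ a} p.toLE ⟨fun u v => q.le u.1 v.1⟩)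

def produces {n : ℕ} (x : Causet n) (y : Causet (n + 1)) : Prop :=
  ∃ (p : PO n) (q : PO (n + 1)),
    Quotient.mk (causetSetoid n) p = x ∧ Quotient.mk (causetSetoid (n + 1)) q = y ∧
      producesPO p q


/-- The poset `y ∖ {a}`: the order on `Fin n` obtained by deleting the element `a`
from the poset `(Fin (n+1), q)`, transported along the order-embedding `a.succAbove`
(whose range is the complement of `a`). -/
def delOrder {n : ℕ} (q : PO (n + 1)) (a : Fin (n + 1)) : PO n :=
  @PartialOrder.lift (Fin n) (Fin (n + 1)) q a.succAbove Fin.succAbove_right_injective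

/-- `a` is the maximal (top) element of the chain `C` in the poset `(Fin (n+1), q)`. -/
def isTopChain {n : ℕ} (q : PO (n + 1)) (C : Set (Fin (n + 1))) (a : Fin (n + 1)) : Prop :=
  a ∈ C ∧ ∀ b ∈ C, q.le b a

/-- The maximal chains of the poset `(Fin (n+1), q)`. -/
def MaxChain (n : ℕ) (q : PO (n + 1)) : Type :=
  {C : Set (Fin (n + 1)) // IsMaxChain q.le C}

/-- Two maximal chains are equivalent if deleting their maximal elements yields
order-isomorphic posets. -/
def chainRel {n : ℕ} (q : PO (n + 1)) (C₁ C₂ : MaxChain n q) : Prop :=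
  ∃ a₁ a₂ : Fin (n + 1), isTopChain q C₁.1 a₁ ∧ isTopChain q C₂.1 a₂ ∧
    poIso (delOrder q a₁) (delOrder q a₂)

/-- A maximal chain of a nonempty finite poset has a top element. -/
theorem exists_isTopChain {n : ℕ} {q : PO (n + 1)} {C : Set (Fin (n + 1))}
    (hC : IsMaxChain q.le C) : ∃ a, isTopChain q C a := by
  have hne : C.Nonempty := by
    by_contra h
    rw [Set.not_nonempty_iff_eq_empty] at h
    subst h
    exact Set.singleton_ne_empty (0 : Fin (n + 1))
      (hC.2 Set.subsingleton_singleton.isChain (Set.empty_subset _)).symm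
  obtain ⟨a, ha, hmax⟩ := @Set.Finite.exists_maximal _ q.toLE ⟨q.le_trans⟩ _ C.toFinite hne
  refine ⟨a, ha, fun b hb => ?_⟩
  rcases hC.1.total ha hb with h | h
  · exact hmax hb h
  · exact h

theorem isTopChain.eq {n : ℕ} {q : PO (n + 1)} {C : Set (Fin (n + 1))} {a b : Fin (n + 1)}
    (ha : isTopChain q C a) (hb : isTopChain q C b) : a = b :=
  q.le_antisymm _ _ (hb.2 a ha.1) (ha.2 b hb.1)

/-- The top of a maximal chain is a maximal element of the poset. -/
theorem isTopChain.maximal {n : ℕ} {q : PO (n + 1)} {C : Set (Fin (n + 1))} {a : Fin (n + 1)}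
    (ha : isTopChain q C a) (hC : IsMaxChain q.le C) (b : Fin (n + 1)) (hab : q.le a b) :
    b = a := by
  have hchain : IsChain q.le (insert b C) :=
    hC.1.insert fun c hc _ => Or.inr (q.le_trans _ _ _ (ha.2 c hc) hab)
  have hb : b ∈ C := by
    rw [hC.2 hchain (Set.subset_insert b C)]
    exact Set.mem_insert b C
  exact q.le_antisymm _ _ (ha.2 b hb) hab

/-- Every maximal element of the poset is the top of a maximal chain. -/
theorem exists_isMaxChain_isTopChain {n : ℕ} {q : PO (n + 1)} {a : Fin (n + 1)}
    (ha : ∀ b, q.le a b → b = a) : ∃ C, IsMaxChain q.le C ∧ isTopChain q C a := by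
  have hchain : IsChain q.le {a} := Set.subsingleton_singleton.isChain
  obtain ⟨C, hC, haC⟩ := hchain.exists_maxChain
  have haC : a ∈ C := haC rfl
  refine ⟨C, hC, haC, fun b hb => ?_⟩
  rcases hC.1.total haC hb with h | h
  · exact ha b h ▸ q.le_refl b
  · exact h

/-- The order `delOrder q a` is isomorphic to the order induced by `q` off `a`. -/
def delOrderIso {n : ℕ} (q : PO (n + 1)) (a : Fin (n + 1)) :
    @OrderIso (Fin n) {b : Fin (n + 1) // b ≠ a} (delOrder q a).toLE
      ⟨fun u v => q.le u.1 v.1⟩ :=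
  @RelIso.mk _ _ _ _ (finSuccAboveEquiv a) Iff.rfl

/-- The producers of `y` are the classes of `y ∖ {a}` for `a` maximal in `y`. -/
theorem produces_mk_iff {n : ℕ} {q : PO (n + 1)} {x : Causet n} :
    produces x (Quotient.mk (causetSetoid (n + 1)) q) ↔
      ∃ a, (∀ b, q.le a b → b = a) ∧ Quotient.mk (causetSetoid n) (delOrder q a) = x := by
  constructor
  · rintro ⟨p, q', rfl, hq, a, ha, ⟨f⟩⟩
    obtain ⟨e⟩ : poIso q' q := Quotient.exact hq
    refine ⟨e a, fun b hb => ?_, Quotient.sound ?_⟩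
    · have h : q'.le a (e.toEquiv.symm b) := by
        refine e.map_rel_iff'.1 ?_
        rw [Equiv.apply_symm_apply]
        exact hb
      exact e.toEquiv.symm_apply_eq.1 (ha _ h)
    · let g : {b : Fin (n + 1) // b ≠ a} ≃ {b : Fin (n + 1) // b ≠ e a} :=
        e.toEquiv.subtypeEquiv fun b => not_congr e.toEquiv.injective.eq_iff.symm
      refine (causetSetoid n).symm ⟨@RelIso.mk _ _ _ _
        ((f.toEquiv.trans g).trans (delOrderIso q (e a)).toEquiv.symm) ?_⟩
      intro u v
      refine (delOrderIso q (e a)).map_rel_iff'.symm.trans ?_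
      simp only [Equiv.trans_apply, Equiv.apply_symm_apply]
      exact e.map_rel_iff'.trans f.map_rel_iff'
  · rintro ⟨a, ha, rfl⟩
    exact ⟨delOrder q a, q, rfl, rfl, a, ha, ⟨delOrderIso q a⟩⟩

/-- The map sending (the equivalence class of) a maximal chain `C` of `y` with maximal
element `a` to the isomorphism class of `y ∖ {a}` is well defined, descends to the
quotient by the equivalence, and is a bijection onto the set of isomorphism classes of
producers of `y`.  In particular the number of producers of `y` equals the number of
equivalence classes of maximal chains in `y`. -/
theorem producers_biject_with_maxChain_classes (n : ℕ) (q : PO (n + 1)) :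
    (∃ Φ : MaxChain n q → Causet n,
      (∀ (C : MaxChain n q) (a : Fin (n + 1)), isTopChain q C.1 a →
        Φ C = Quotient.mk (causetSetoid n) (delOrder q a)) ∧
      (∀ C₁ C₂ : MaxChain n q, Φ C₁ = Φ C₂ ↔ chainRel q C₁ C₂) ∧
      Set.range Φ = {x : Causet n | produces x (Quotient.mk (causetSetoid (n + 1)) q)}) ∧
    Nat.card (Quot (chainRel q)) =
      Nat.card {x : Causet n // produces x (Quotient.mk (causetSetoid (n + 1)) q)} := by
  choose top htop using fun C : MaxChain n q => exists_isTopChain C.2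
  have hΦ : ∀ (C : MaxChain n q) (a : Fin (n + 1)), isTopChain q C.1 a → top C = a :=
    fun C a ha => (htop C).eq ha
  let Φ : MaxChain n q → Causet n := fun C => Quotient.mk (causetSetoid n) (delOrder q (top C))
  have hrel : ∀ C₁ C₂ : MaxChain n q, Φ C₁ = Φ C₂ ↔ chainRel q C₁ C₂ := by
    intro C₁ C₂
    constructor
    · intro h
      exact ⟨_, _, htop C₁, htop C₂, Quotient.exact h⟩
    · rintro ⟨a₁, a₂, h₁, h₂, h⟩
      obtain rfl := hΦ C₁ a₁ h₁
      obtain rfl := hΦ C₂ a₂ h₂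
      exact Quotient.sound h
  have hrange : Set.range Φ =
      {x : Causet n | produces x (Quotient.mk (causetSetoid (n + 1)) q)} := by
    ext x
    rw [Set.mem_ofPred_eq, produces_mk_iff]
    constructor
    · rintro ⟨C, rfl⟩
      exact ⟨top C, (htop C).maximal C.2, rfl⟩
    · rintro ⟨a, ha, rfl⟩
      obtain ⟨C, hC, haC⟩ := exists_isMaxChain_isTopChain ha
      exact ⟨⟨C, hC⟩, by rw [← hΦ ⟨C, hC⟩ a haC]⟩
  refine ⟨⟨Φ, fun C a ha => by rw [← hΦ C a ha], hrel, hrange⟩, ?_⟩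
  have hinj : Function.Injective (Quot.lift Φ fun C₁ C₂ h => (hrel C₁ C₂).2 h) := by
    rintro ⟨C₁⟩ ⟨C₂⟩ h
    exact Quot.sound ((hrel C₁ C₂).1 h)
  have hcard := Nat.card_range_of_injective hinj
  rw [Set.range_quot_lift, hrange] at hcard
  exact hcard.symm

end
end

section
/- Let ã be a transition amplitude on the causets P and let {a_n} be the corresponding amplitude process. Define ρ_n on H_n = L²(Ω_n) by ρ_n f = ⟨a_n, f⟩ a_n (i.e., ρ_n = |a_n⟩⟨a_n|). Then: (i) Σ_{ω ∈ Ω_n} a_n(ω) = 1 for every n, so each ρ_n is a probability operator; and (ii) the sequence {ρ_n} is consistent, i.e., D_{ρ_{n+1}}((A→),(B→)) = D_{ρ_n}(A,B) for all A, B ⊆ Ω_n. Hence {ρ_n} is a quantum sequential growth process. -/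
open scoped Classical ComplexOrder

noncomputable section

/-- The space of `n`-paths `ω₁ω₂⋯ω_n` with `ω_i` a causet of cardinality `i`
and `ω_i → ω_{i+1}`. -/
def Omega (n : ℕ) : Type :=
  {ω : ∀ i : Fin n, Causet ((i : ℕ) + 1) //
    ∀ (i : Fin n) (h : (i : ℕ) + 1 < n), produces (ω i) (ω ⟨(i : ℕ) + 1, h⟩)}

instance (n : ℕ) : Finite (Omega n) := Subtype.finite
instance (n : ℕ) : Fintype (Omega n) := Fintype.ofFinite _

/-- The inner product on `H_n = L²(Ω_n)`, conjugate-linear in the first argument. -/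
def ip {n : ℕ} (f g : Omega n → ℂ) : ℂ := ∑ ω, (starRingEnd ℂ) (f ω) * g ω

/-- The constant function `1_n`. -/
def oneV (n : ℕ) : Omega n → ℂ := fun _ => 1

/-- The characteristic function of `A ⊆ Ω_n`. -/
def chi {n : ℕ} (A : Set (Omega n)) : Omega n → ℂ := A.indicator fun _ => 1

/-- The decoherence functional `D_ρ(A,B) = ⟨ρ χ_B, χ_A⟩`. -/
def Dfun {n : ℕ} (ρ : (Omega n → ℂ) →ₗ[ℂ] (Omega n → ℂ)) (A B : Set (Omega n)) : ℂ :=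
  ip (ρ (chi B)) (chi A)

/-- The q-measure `μ_ρ(A) = D_ρ(A,A)`. -/
def muf {n : ℕ} (ρ : (Omega n → ℂ) →ₗ[ℂ] (Omega n → ℂ)) (A : Set (Omega n)) : ℂ :=
  Dfun ρ A A

/-- Truncation of an `(n+1)`-path to an `n`-path; `omegaRes ⁻¹' A` is the set `(A →)`
of one-step continuations of paths in `A`. -/
def omegaRes {n : ℕ} (ω : Omega (n + 1)) : Omega n :=
  ⟨fun i => ω.1 ⟨(i : ℕ), Nat.lt_succ_of_lt i.2⟩,
   fun i h => ω.2 ⟨(i : ℕ), Nat.lt_succ_of_lt i.2⟩ (Nat.lt_succ_of_lt h)⟩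

/-- A quantum sequential growth process: a consistent sequence of probability
operators `ρ_n` on `H_n = L²(Ω_n)`. -/
structure QSGP where
  rho : ∀ n : ℕ, (Omega n → ℂ) →ₗ[ℂ] (Omega n → ℂ)
  pos : ∀ (n : ℕ) (f : Omega n → ℂ), 0 ≤ ip (rho n f) f
  normal : ∀ n : ℕ, ip (rho n (oneV n)) (oneV n) = 1
  consistent : ∀ (n : ℕ) (A B : Set (Omega n)),
    Dfun (rho (n + 1)) (omegaRes ⁻¹' A) (omegaRes ⁻¹' B) = Dfun (rho n) A B
/-- `⟨a, ·⟩` as a linear functional. -/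
def ipL {n : ℕ} (a : Omega n → ℂ) : (Omega n → ℂ) →ₗ[ℂ] ℂ where
  toFun g := ip a g
  map_add' f g := by
    simp only [ip, Pi.add_apply, mul_add, Finset.sum_add_distrib]
  map_smul' c f := by
    simp only [ip, Pi.smul_apply, smul_eq_mul, RingHom.id_apply, Finset.mul_sum]
    exact Finset.sum_congr rfl fun ω _ => by ring

/-- The rank-one operator `|a⟩⟨a| : f ↦ ⟨a,f⟩ a`. -/
def rankOne {n : ℕ} (a : Omega n → ℂ) : (Omega n → ℂ) →ₗ[ℂ] (Omega n → ℂ) :=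
  (ipL a).smulRight a

/-- The amplitude process `a_n(ω₁⋯ω_n) = ã(ω₁,ω₂)⋯ã(ω_{n-1},ω_n)` corresponding to a
transition amplitude `ã` (given as a family `ta n : Causet (n+1) → Causet (n+2) → ℂ`). -/
def amp (ta : ∀ n : ℕ, Causet (n + 1) → Causet (n + 2) → ℂ) : ∀ n : ℕ, Omega n → ℂ
  | 0, _ => 1
  | 1, _ => 1
  | (n + 2), ω =>
      amp ta (n + 1) (omegaRes ω) *
        ta n (ω.1 ⟨n, by omega⟩) (ω.1 ⟨n + 1, by omega⟩)

instance : Subsingleton (PO 1) where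
  allEq p q := PartialOrder.ext fun a b => by
    obtain rfl := Subsingleton.elim a b
    exact iff_of_true (p.le_refl a) (q.le_refl a)

instance : Unique (Causet 1) where
  default := Quotient.mk (causetSetoid 1) inferInstance
  uniq x := by
    induction x using Quotient.inductionOn with
    | h p => exact congrArg _ (Subsingleton.elim p _)

instance : Unique (Omega 0) where
  default := ⟨fun i => i.elim0, fun i => i.elim0⟩
  uniq _ := Subtype.ext (funext fun i => i.elim0)

instance : Unique (Omega 1) where
  default := ⟨fun i => (Subsingleton.elim 0 i) ▸ (default : Causet 1), fun i h => by omega⟩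
  uniq ω := Subtype.ext <| funext fun i => by
    obtain rfl := Subsingleton.elim 0 i
    exact Unique.eq_default (α := Causet 1) _

/-- The endpoint of a nonempty path. -/
def omegaLast {n : ℕ} (ω : Omega (n + 1)) : Causet (n + 1) := ω.1 (Fin.last n)

/-- The one-step continuation of a path by an offspring of its endpoint. -/
def omegaExtend {n : ℕ} (ω : Omega (n + 1)) (y : Causet (n + 2))
    (h : produces (omegaLast ω) y) : Omega (n + 2) :=
  ⟨Fin.snoc (α := fun i : Fin (n + 2) => Causet ((i : ℕ) + 1)) ω.1 y, fun i hi => by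
    have hi' : (i : ℕ) < n + 1 := by omega
    by_cases hn : (i : ℕ) + 1 < n + 1
    · simpa [Fin.snoc, hi', hn, Fin.castLT] using ω.2 ⟨i, hi'⟩ hn
    · obtain ⟨i, hi₀⟩ := i
      obtain rfl : i = n := by simp only at hn hi'; omega
      simpa [Fin.snoc, omegaLast, Fin.last] using h⟩

theorem omegaRes_omegaExtend {n : ℕ} (ω : Omega (n + 1)) (y : Causet (n + 2))
    (h : produces (omegaLast ω) y) : omegaRes (omegaExtend ω y h) = ω := by
  refine Subtype.ext (funext fun i => ?_)
  exact Fin.snoc_castSucc (α := fun i : Fin (n + 2) => Causet ((i : ℕ) + 1)) y ω.1 i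

theorem omegaLast_omegaExtend {n : ℕ} (ω : Omega (n + 1)) (y : Causet (n + 2))
    (h : produces (omegaLast ω) y) : omegaLast (omegaExtend ω y h) = y :=
  Fin.snoc_last (α := fun i : Fin (n + 2) => Causet ((i : ℕ) + 1)) y ω.1

theorem Omega.ext_res_last {n : ℕ} {ω ω' : Omega (n + 1)} (hres : omegaRes ω = omegaRes ω')
    (hlast : omegaLast ω = omegaLast ω') : ω = ω' := by
  refine Subtype.ext (funext fun i => ?_)
  induction i using Fin.lastCases with
  | last => exact hlast
  | cast i => exact congrFun (congrArg Subtype.val hres) i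

theorem sum_continuations {n : ℕ} (ω : Omega (n + 1)) (g : Causet (n + 2) → ℂ)
    (hg : ∀ y, ¬ produces (omegaLast ω) y → g y = 0) :
    ∑ ω' : Omega (n + 2) with omegaRes ω' = ω, g (omegaLast ω') = ∑ y, g y := by
  refine Finset.sum_of_injOn omegaLast ?_ (fun _ _ => Finset.mem_coe.2 (Finset.mem_univ _)) ?_
    (fun _ _ => rfl)
  · intro ω₁ h₁ ω₂ h₂ h
    simp only [Finset.coe_filter, Finset.mem_univ, true_and, Set.mem_ofPred_eq] at h₁ h₂
    exact Omega.ext_res_last (h₁.trans h₂.symm) h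
  · intro y _ hy
    refine hg y fun h => hy ⟨omegaExtend ω y h, ?_, omegaLast_omegaExtend ω y h⟩
    simpa using omegaRes_omegaExtend ω y h

theorem sum_amp_continuations (ta : ∀ n : ℕ, Causet (n + 1) → Causet (n + 2) → ℂ)
    (hzero : ∀ (n : ℕ) (x : Causet (n + 1)) (y : Causet (n + 2)),
      ¬ produces x y → ta n x y = 0)
    (hsum : ∀ (n : ℕ) (x : Causet (n + 1)), ∑ y : Causet (n + 2), ta n x y = 1)
    (n : ℕ) (ω : Omega n) :
    ∑ ω' : Omega (n + 1) with omegaRes ω' = ω, amp ta (n + 1) ω' = amp ta n ω := by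
  cases n with
  | zero =>
    rw [Finset.filter_true_of_mem fun _ _ => Subsingleton.elim _ _]
    exact Fintype.sum_unique (ι := Omega 1) _
  | succ n =>
    calc ∑ ω' : Omega (n + 2) with omegaRes ω' = ω, amp ta (n + 2) ω'
        = ∑ ω' : Omega (n + 2) with omegaRes ω' = ω,
            amp ta (n + 1) ω * ta n (omegaLast ω) (omegaLast ω') := by
          refine Finset.sum_congr rfl fun ω' h => ?_
          obtain rfl := (Finset.mem_filter.1 h).2
          rfl
      _ = amp ta (n + 1) ω := by
          rw [← Finset.mul_sum, sum_continuations ω _ (hzero n _), hsum, mul_one]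

theorem ip_amp_comp_omegaRes (ta : ∀ n : ℕ, Causet (n + 1) → Causet (n + 2) → ℂ)
    (hzero : ∀ (n : ℕ) (x : Causet (n + 1)) (y : Causet (n + 2)),
      ¬ produces x y → ta n x y = 0)
    (hsum : ∀ (n : ℕ) (x : Causet (n + 1)), ∑ y : Causet (n + 2), ta n x y = 1)
    (n : ℕ) (f : Omega n → ℂ) :
    ip (amp ta (n + 1)) (f ∘ omegaRes) = ip (amp ta n) f := by
  unfold ip
  rw [← Finset.sum_fiberwise _ omegaRes]
  refine Finset.sum_congr rfl fun ω _ => ?_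
  rw [← sum_amp_continuations ta hzero hsum n ω, map_sum, Finset.sum_mul]
  refine Finset.sum_congr rfl fun ω' h => ?_
  rw [Function.comp_apply, (Finset.mem_filter.1 h).2]

theorem sum_amp_eq_one (ta : ∀ n : ℕ, Causet (n + 1) → Causet (n + 2) → ℂ)
    (hzero : ∀ (n : ℕ) (x : Causet (n + 1)) (y : Causet (n + 2)),
      ¬ produces x y → ta n x y = 0)
    (hsum : ∀ (n : ℕ) (x : Causet (n + 1)), ∑ y : Causet (n + 2), ta n x y = 1)
    (n : ℕ) : ∑ ω : Omega n, amp ta n ω = 1 := by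
  induction n with
  | zero => simp [amp]
  | succ n ih =>
    rw [← ih, ← Finset.sum_fiberwise _ omegaRes]
    exact Finset.sum_congr rfl fun ω _ => sum_amp_continuations ta hzero hsum n ω

theorem ip_rankOne {n : ℕ} (a f g : Omega n → ℂ) :
    ip (rankOne a f) g = (starRingEnd ℂ) (ip a f) * ip a g := by
  change ∑ ω, (starRingEnd ℂ) (ip a f * a ω) * g ω = _
  simp only [map_mul, mul_assoc, ← Finset.mul_sum]
  rfl

/-- Given a transition amplitude `ã` (vanishing off the produce relation and with
`Σ_y ã(x,y) = 1` for every causet `x`), the corresponding amplitude process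
`a_n(ω₁⋯ω_n) = ã(ω₁,ω₂)⋯ã(ω_{n-1},ω_n)` satisfies `Σ_{ω∈Ω_n} a_n(ω) = 1`, each
`ρ_n = |a_n⟩⟨a_n|` is a probability operator, and the sequence `{ρ_n}` is consistent;
hence `{ρ_n}` is a quantum sequential growth process. -/
theorem amplitude_process_gives_QSGP
    (ta : ∀ n : ℕ, Causet (n + 1) → Causet (n + 2) → ℂ)
    (hzero : ∀ (n : ℕ) (x : Causet (n + 1)) (y : Causet (n + 2)),
      ¬ produces x y → ta n x y = 0)
    (hsum : ∀ (n : ℕ) (x : Causet (n + 1)), ∑ y : Causet (n + 2), ta n x y = 1) :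
    (∀ n : ℕ, ∑ ω : Omega n, amp ta n ω = 1) ∧
    (∀ (n : ℕ) (f : Omega n → ℂ), 0 ≤ ip (rankOne (amp ta n) f) f) ∧
    (∀ n : ℕ, ip (rankOne (amp ta n) (oneV n)) (oneV n) = 1) ∧
    (∀ (n : ℕ) (A B : Set (Omega n)),
      Dfun (rankOne (amp ta (n + 1))) (omegaRes ⁻¹' A) (omegaRes ⁻¹' B) =
        Dfun (rankOne (amp ta n)) A B) := by
  refine ⟨sum_amp_eq_one ta hzero hsum, fun n f => ?_, fun n => ?_, fun n A B => ?_⟩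
  · rw [ip_rankOne]
    exact star_mul_self_nonneg _
  · have h : ip (amp ta n) (oneV n) = 1 := by
      simp only [ip, oneV, mul_one, ← map_sum, sum_amp_eq_one ta hzero hsum n, map_one]
    rw [ip_rankOne, h, map_one, mul_one]
  · have h (C : Set (Omega n)) :
        ip (amp ta (n + 1)) (chi (omegaRes ⁻¹' C)) = ip (amp ta n) (chi C) :=
      ip_amp_comp_omegaRes ta hzero hsum n (chi C)
    rw [Dfun, Dfun, ip_rankOne, ip_rankOne, h, h]

end
end

section
/- For a quantum sequential growth process {ρ_n}, the following statements are equivalent: (a) {ρ_n} is semiclassical, i.e., for every n and all ω ≠ ω' in Ω_n, Re D_n({ω},{ω'}) = 0; (b) for every n and all A, B ⊆ Ω_n, Re D_n(A,B) = μ_n(A ∩ B); (c) for every n and all A, B ⊆ Ω_n with A ∩ B = ∅, Re D_n(A,B) = 0; (d) every μ_n is finitely additive: μ_n(A ∪ B) = μ_n(A) + μ_n(B) whenever A ∩ B = ∅. -/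
open scoped Classical ComplexOrder

noncomputable section

lemma ip_add_left {n : ℕ} (f g h : Omega n → ℂ) : ip (f + g) h = ip f h + ip g h := by
  simp [ip, add_mul, Finset.sum_add_distrib]

lemma ip_add_right {n : ℕ} (f g h : Omega n → ℂ) : ip f (g + h) = ip f g + ip f h := by
  simp [ip, mul_add, Finset.sum_add_distrib]

lemma ip_smul_left {n : ℕ} (c : ℂ) (f g : Omega n → ℂ) :
    ip (c • f) g = (starRingEnd ℂ) c * ip f g := by
  simp [ip, Finset.mul_sum, mul_assoc]

lemma ip_smul_right {n : ℕ} (c : ℂ) (f g : Omega n → ℂ) : ip f (c • g) = c * ip f g := by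
  simp [ip, Finset.mul_sum, mul_left_comm]

lemma chi_union {n : ℕ} {A B : Set (Omega n)} (h : Disjoint A B) :
    chi (A ∪ B) = chi A + chi B :=
  Set.indicator_union_of_disjoint h _

section Decoherence

variable {n : ℕ} (ρ : (Omega n → ℂ) →ₗ[ℂ] (Omega n → ℂ))

lemma Dfun_union_left {A B : Set (Omega n)} (h : Disjoint A B) (C : Set (Omega n)) :
    Dfun ρ (A ∪ B) C = Dfun ρ A C + Dfun ρ B C := by
  simp [Dfun, chi_union h, ip_add_right]

lemma Dfun_union_right {A B : Set (Omega n)} (h : Disjoint A B) (C : Set (Omega n)) :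
    Dfun ρ C (A ∪ B) = Dfun ρ C A + Dfun ρ C B := by
  simp [Dfun, chi_union h, ip_add_left]

lemma Dfun_empty_left (C : Set (Omega n)) : Dfun ρ ∅ C = 0 := by
  simp [Dfun, chi, ip]

lemma Dfun_empty_right (C : Set (Omega n)) : Dfun ρ C ∅ = 0 := by
  have h : chi (∅ : Set (Omega n)) = 0 := Set.indicator_empty _
  simp [Dfun, h, ip]

lemma re_ip_comm (hρ : ∀ f, 0 ≤ ip (ρ f) f) (f g : Omega n → ℂ) :
    (ip (ρ f) g).re = (ip (ρ g) f).re := by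
  have him : ∀ f, (ip (ρ f) f).im = 0 := fun f => (Complex.nonneg_iff.mp (hρ f)).2.symm
  have h := him (f + Complex.I • g)
  simp only [map_add, map_smul, ip_add_left, ip_add_right, ip_smul_left, ip_smul_right,
    Complex.add_im, Complex.mul_im, Complex.add_re, Complex.mul_re, Complex.conj_I,
    Complex.neg_re, Complex.neg_im, Complex.I_re, Complex.I_im, him f, him g] at h
  linarith

lemma re_Dfun_eq_zero_of_disjoint
    (h : ∀ ω ω' : Omega n, ω ≠ ω' → (Dfun ρ {ω} {ω'}).re = 0)
    {A B : Set (Omega n)} (hAB : Disjoint A B) : (Dfun ρ A B).re = 0 := by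
  have hsingle : ∀ (ω : Omega n) (B : Set (Omega n)), ω ∉ B → (Dfun ρ {ω} B).re = 0 := by
    intro ω B
    induction B, B.toFinite using Set.Finite.induction_on with
    | empty => simp [Dfun_empty_right]
    | @insert b s hb _ ih =>
      intro hω
      rw [Set.mem_insert_iff, not_or] at hω
      rw [Set.insert_eq, Dfun_union_right ρ (Set.disjoint_singleton_left.mpr hb), Complex.add_re,
        h _ _ hω.1, ih hω.2, add_zero]
  induction A, A.toFinite using Set.Finite.induction_on with
  | empty => simp [Dfun_empty_left]
  | @insert a s ha _ ih =>
    rw [Set.disjoint_insert_left] at hAB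
    rw [Set.insert_eq, Dfun_union_left ρ (Set.disjoint_singleton_left.mpr ha), Complex.add_re,
      hsingle _ _ hAB.1, ih hAB.2, add_zero]

lemma re_Dfun_eq_re_muf_inter (h : ∀ A B : Set (Omega n), A ∩ B = ∅ → (Dfun ρ A B).re = 0)
    (A B : Set (Omega n)) : (Dfun ρ A B).re = (muf ρ (A ∩ B)).re := by
  have hA : Dfun ρ A B = Dfun ρ (A ∩ B) B + Dfun ρ (A \ B) B := by
    rw [← Dfun_union_left ρ (Set.disjoint_sdiff_inter.symm), Set.inter_union_sdiff]
  have hB : Dfun ρ (A ∩ B) B = Dfun ρ (A ∩ B) (B ∩ A) + Dfun ρ (A ∩ B) (B \ A) := by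
    rw [← Dfun_union_right ρ (Set.disjoint_sdiff_inter.symm), Set.inter_union_sdiff]
  rw [hA, hB, Complex.add_re, Complex.add_re, h (A \ B) B (by grind),
    h (A ∩ B) (B \ A) (by grind), Set.inter_comm B A, add_zero, add_zero, muf]

lemma muf_im (hρ : ∀ f, 0 ≤ ip (ρ f) f) (A : Set (Omega n)) : (muf ρ A).im = 0 :=
  (Complex.nonneg_iff.mp (hρ _)).2.symm

lemma re_muf_union (hρ : ∀ f, 0 ≤ ip (ρ f) f) {A B : Set (Omega n)} (h : Disjoint A B) :
    (muf ρ (A ∪ B)).re = (muf ρ A).re + (muf ρ B).re + 2 * (Dfun ρ A B).re := by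
  have hcomm : (Dfun ρ A B).re = (Dfun ρ B A).re := re_ip_comm ρ hρ _ _
  simp only [muf, Dfun_union_left ρ h, Dfun_union_right ρ h, Complex.add_re]
  linarith

lemma muf_union_iff (hρ : ∀ f, 0 ≤ ip (ρ f) f) {A B : Set (Omega n)} (h : Disjoint A B) :
    muf ρ (A ∪ B) = muf ρ A + muf ρ B ↔ (Dfun ρ A B).re = 0 := by
  rw [Complex.ext_iff, Complex.add_re, Complex.add_im, muf_im ρ hρ, muf_im ρ hρ, muf_im ρ hρ,
    re_muf_union ρ hρ h]
  simp

end Decoherence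

/-- For a QSGP `{ρ_n}`, the following are equivalent: (a) `{ρ_n}` is semiclassical,
i.e. `Re D_n({ω},{ω'}) = 0` for all `ω ≠ ω'`; (b) `Re D_n(A,B) = μ_n(A ∩ B)`;
(c) `Re D_n(A,B) = 0` whenever `A ∩ B = ∅`; (d) each `μ_n` is finitely additive. -/
theorem semiclassical_iff (Γ : QSGP) :
    ((∀ (n : ℕ) (ω ω' : Omega n), ω ≠ ω' → (Dfun (Γ.rho n) {ω} {ω'}).re = 0) ↔
      (∀ (n : ℕ) (A B : Set (Omega n)),
        (((Dfun (Γ.rho n) A B).re : ℂ)) = muf (Γ.rho n) (A ∩ B))) ∧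
    ((∀ (n : ℕ) (ω ω' : Omega n), ω ≠ ω' → (Dfun (Γ.rho n) {ω} {ω'}).re = 0) ↔
      (∀ (n : ℕ) (A B : Set (Omega n)), A ∩ B = ∅ → (Dfun (Γ.rho n) A B).re = 0)) ∧
    ((∀ (n : ℕ) (ω ω' : Omega n), ω ≠ ω' → (Dfun (Γ.rho n) {ω} {ω'}).re = 0) ↔
      (∀ (n : ℕ) (A B : Set (Omega n)), A ∩ B = ∅ →
        muf (Γ.rho n) (A ∪ B) = muf (Γ.rho n) A + muf (Γ.rho n) B)) := by
  have hac : (∀ (n : ℕ) (ω ω' : Omega n), ω ≠ ω' → (Dfun (Γ.rho n) {ω} {ω'}).re = 0) ↔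
      ∀ (n : ℕ) (A B : Set (Omega n)), A ∩ B = ∅ → (Dfun (Γ.rho n) A B).re = 0 :=
    ⟨fun h n _ _ hAB =>
      re_Dfun_eq_zero_of_disjoint _ (h n) (Set.disjoint_iff_inter_eq_empty.mpr hAB),
     fun h n ω ω' hne => h n _ _ (Set.singleton_inter_eq_empty.mpr hne)⟩
  refine ⟨hac.trans ⟨fun h n A B => ?_, fun h n A B hAB => ?_⟩, hac, hac.trans ?_⟩
  · rw [re_Dfun_eq_re_muf_inter _ (h n)]
    exact Complex.ext rfl (muf_im _ (Γ.pos n) _).symm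
  · have := h n A B
    rw [hAB, muf, Dfun_empty_left] at this
    exact_mod_cast this
  · exact forall₄_congr fun n A B hAB =>
      (muf_union_iff _ (Γ.pos n) (Set.disjoint_iff_inter_eq_empty.mpr hAB)).symm

end
end

section
/- Let {ρ_n} be a semiclassical quantum sequential growth process. Then for every subset A of the path space Ω and every n, μ_{n+1}(A^{n+1}) ≤ μ_n(A^n); hence the sequence n ↦ μ_n(A^n) is nonincreasing (and nonnegative), so lim_n μ_n(A^n) exists, i.e., every subset A of Ω is suitable. -/
open scoped Classical ComplexOrder

noncomputable section

/-- The space `Ω` of infinite paths `ω₀ω₁ω₂⋯` in the causet growth process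
(`ω₀` is the empty causet, by convention). -/
def CPath : Type := {ω : ∀ i : ℕ, Causet i // ∀ i : ℕ, produces (ω i) (ω (i + 1))}

/-- The collection of all causets (of any cardinality). -/
def CP : Type := Σ n : ℕ, Causet n

/-- The causet `ω_k` occurring at stage `k` in a path `ω`. -/
def pt (ω : CPath) (k : ℕ) : CP := ⟨k, ω.1 k⟩

/-- Kronecker delta. -/
def kdel (a b : CP) : ℂ := if a = b then 1 else 0

/-- The covariant bidifference operator `∇_{ω,ω'}`. -/
def nabla (D : CP → CP → ℂ) (ω ω' : CPath) (f : CP → CP → ℂ) (x y : CP) : ℂ :=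
  (D (pt ω (x.1 - 1)) (pt ω' (y.1 - 1)) * f x y -
      D x y * f (pt ω (x.1 - 1)) (pt ω' (y.1 - 1))) *
    kdel x (pt ω x.1) * kdel y (pt ω' y.1)

/-- The discrete curvature operator `R_{ω,ω'} = ∇_{ω,ω'} − ∇_{ω',ω}`. -/
def curvOp (D : CP → CP → ℂ) (ω ω' : CPath) (f : CP → CP → ℂ) (x y : CP) : ℂ :=
  nabla D ω ω' f x y - nabla D ω' ω f x y

/-- The discrete metric operator `𝒟_{ω,ω'}`. -/
def metOp (D : CP → CP → ℂ) (ω ω' : CPath) (f : CP → CP → ℂ) (x y : CP) : ℂ :=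
  D x y *
    (f (pt ω' (x.1 - 1)) (pt ω (y.1 - 1)) * kdel x (pt ω' x.1) * kdel y (pt ω y.1) -
      f (pt ω (x.1 - 1)) (pt ω' (y.1 - 1)) * kdel x (pt ω x.1) * kdel y (pt ω' y.1))

/-- The discrete mass-energy operator `𝒯_{ω,ω'}`. -/
def massOp (D : CP → CP → ℂ) (ω ω' : CPath) (f : CP → CP → ℂ) (x y : CP) : ℂ :=
  (D (pt ω (x.1 - 1)) (pt ω' (y.1 - 1)) * kdel x (pt ω x.1) * kdel y (pt ω' y.1) -
      D (pt ω' (x.1 - 1)) (pt ω (y.1 - 1)) * kdel x (pt ω' x.1) * kdel y (pt ω y.1)) *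
    f x y

/-- The basis vector `e_x ⊗ e_y`: the indicator function of `{(x,y)}` on `P × P`. -/
def ee (a b : CP) : CP → CP → ℂ := fun u v => kdel u a * kdel v b

/-- A path `ω` contains the causet `x` if `ω_{|x|} = x`. -/
def containsC (ω : CPath) (x : CP) : Prop := pt ω x.1 = x

/-- `(x,y)` is an `(ω,ω')` pair if `ω` contains `x` and `ω'` contains `y`. -/
def isPair (ω ω' : CPath) (x y : CP) : Prop := containsC ω x ∧ containsC ω' y

/-- The ℓ²-inner product on finitely supported functions on `P × P`,
conjugate-linear in the first argument. -/
def ipP (f g : CP → CP → ℂ) : ℂ := ∑ᶠ p : CP × CP, (starRingEnd ℂ) (f p.1 p.2) * g p.1 p.2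
/-- The causet occurring at stage `i+1` of an `n`-path, as an element of `P`. -/
def cpAt {n : ℕ} (ω : Omega n) (i : Fin n) : CP := ⟨(i : ℕ) + 1, ω.1 i⟩

/-- An `n`-path `ω` contains the causet `x` if `ω_{|x|} = x`. -/
def containsOm {n : ℕ} (ω : Omega n) (x : CP) : Prop := ∃ i : Fin n, cpAt ω i = x

/-- The set `A_x = {ω ∈ Ω_n : ω_{|x|} = x}`. -/
def Aset (n : ℕ) (x : CP) : Set (Omega n) := {ω | containsOm ω x}

/-- The site decoherence `D(x,y) = D_n(A_x, A_y)`, computed at `n = max(|x|,|y|)`. -/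
def siteD (Γ : QSGP) (x y : CP) : ℂ :=
  Dfun (Γ.rho (max x.1 y.1)) (Aset (max x.1 y.1) x) (Aset (max x.1 y.1) y)

/-- Truncation `ω ↦ ω₁⋯ω_m` of an infinite path to an `m`-path. -/
def trunc (ω : CPath) (m : ℕ) : Omega m :=
  ⟨fun i => ω.1 ((i : ℕ) + 1), fun i _ => ω.2 ((i : ℕ) + 1)⟩

/-- `A^m`, the set of `m`-step truncations of paths in `A ⊆ Ω`. -/
def truncSet (A : Set CPath) (m : ℕ) : Set (Omega m) := (fun ω => trunc ω m) '' A

theorem chi_eq_sum_singleton {n : ℕ} (A : Set (Omega n)) :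
    chi A = ∑ ω ∈ A.toFinset, chi {ω} := by
  funext x
  simp [chi, Finset.sum_apply, Set.indicator_apply]

theorem Dfun_eq_sum_singleton {n : ℕ} (ρ : (Omega n → ℂ) →ₗ[ℂ] (Omega n → ℂ))
    (A B : Set (Omega n)) :
    Dfun ρ A B = ∑ a ∈ A.toFinset, ∑ b ∈ B.toFinset, Dfun ρ {a} {b} := by
  simp only [Dfun, ip]
  conv_lhs => rw [chi_eq_sum_singleton A, chi_eq_sum_singleton B]
  simp only [map_sum, Finset.sum_apply, Finset.sum_mul_sum]
  rw [Finset.sum_comm]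
  simp only [Finset.sum_comm (s := Finset.univ) (t := A.toFinset)]
  rw [Finset.sum_comm]

theorem QSGP.muf_nonneg (Γ : QSGP) (n : ℕ) (A : Set (Omega n)) : 0 ≤ muf (Γ.rho n) A :=
  Γ.pos n (chi A)

theorem re_muf_eq_sum {n : ℕ} (ρ : (Omega n → ℂ) →ₗ[ℂ] (Omega n → ℂ))
    (hρ : ∀ ω ω' : Omega n, ω ≠ ω' → (Dfun ρ {ω} {ω'}).re = 0) (A : Set (Omega n)) :
    (muf ρ A).re = ∑ ω ∈ A.toFinset, (muf ρ {ω}).re := by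
  rw [muf, Dfun_eq_sum_singleton, Complex.re_sum]
  refine Finset.sum_congr rfl fun a ha => ?_
  rw [Complex.re_sum, Finset.sum_eq_single_of_mem a ha fun b _ hb => hρ a b hb.symm]
  rfl

theorem QSGP.muf_mono (Γ : QSGP) (n : ℕ)
    (hn : ∀ ω ω' : Omega n, ω ≠ ω' → (Dfun (Γ.rho n) {ω} {ω'}).re = 0)
    {A B : Set (Omega n)} (hAB : A ⊆ B) : muf (Γ.rho n) A ≤ muf (Γ.rho n) B := by
  rw [Complex.le_def]
  refine ⟨?_, ?_⟩
  · rw [re_muf_eq_sum _ hn, re_muf_eq_sum _ hn]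
    exact Finset.sum_le_sum_of_subset_of_nonneg (Set.toFinset_mono hAB)
      fun ω _ _ => (Complex.le_def.1 (Γ.muf_nonneg n {ω})).1
  · exact (Complex.le_def.1 (Γ.muf_nonneg n A)).2.symm.trans
      (Complex.le_def.1 (Γ.muf_nonneg n B)).2

theorem truncSet_succ_subset (A : Set CPath) (n : ℕ) :
    truncSet A (n + 1) ⊆ omegaRes ⁻¹' truncSet A n := by
  rintro _ ⟨ω, hω, rfl⟩
  exact ⟨ω, hω, rfl⟩

/-- For a semiclassical QSGP, for every subset `A` of the path space `Ω` the sequence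
`n ↦ μ_n(A^n)` is nonincreasing and nonnegative, hence convergent: every `A ⊆ Ω` is
suitable. -/
theorem semiclassical_every_set_suitable (Γ : QSGP)
    (hsc : ∀ (n : ℕ) (ω ω' : Omega n), ω ≠ ω' → (Dfun (Γ.rho n) {ω} {ω'}).re = 0) :
    (∀ (A : Set CPath) (n : ℕ),
      muf (Γ.rho (n + 1)) (truncSet A (n + 1)) ≤ muf (Γ.rho n) (truncSet A n)) ∧
    (∀ (A : Set CPath) (n : ℕ), 0 ≤ muf (Γ.rho n) (truncSet A n)) ∧
    (∀ A : Set CPath, ∃ c : ℂ,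
      Filter.Tendsto (fun n : ℕ => muf (Γ.rho n) (truncSet A n))
        Filter.atTop (nhds c)) := by
  have hanti : ∀ (A : Set CPath) (n : ℕ),
      muf (Γ.rho (n + 1)) (truncSet A (n + 1)) ≤ muf (Γ.rho n) (truncSet A n) := fun A n =>
    (Γ.muf_mono (n + 1) (hsc (n + 1)) (truncSet_succ_subset A n)).trans_eq
      (Γ.consistent n _ _)
  have hnonneg : ∀ (A : Set CPath) (n : ℕ), 0 ≤ muf (Γ.rho n) (truncSet A n) := fun A n =>
    Γ.muf_nonneg n _
  refine ⟨hanti, hnonneg, fun A => ?_⟩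
  have hre : Antitone fun n => (muf (Γ.rho n) (truncSet A n)).re :=
    antitone_nat_of_succ_le fun n => (Complex.le_def.1 (hanti A n)).1
  have hbdd : BddBelow (Set.range fun n => (muf (Γ.rho n) (truncSet A n)).re) := by
    refine ⟨0, ?_⟩
    rintro _ ⟨n, rfl⟩
    exact (Complex.le_def.1 (hnonneg A n)).1
  refine ⟨_, ((Complex.continuous_ofReal.tendsto _).comp
    (tendsto_atTop_ciInf hre hbdd)).congr fun n => ?_⟩
  exact Complex.ext rfl (Complex.le_def.1 (hnonneg A n)).2

end
end
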